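/- For every n ≥ 1 and every subgroup G ≤ S_n, let G̃ = π⁻¹(G) ≤ B_n be the preimage of G under the canonical projection π : B_n → S_n. Then the map H₂(G̃; ℤ) → H₂(G; ℤ) on second group homology (with trivial ℤ coefficients) induced by the restriction of π to G̃ is surjective. -/

import Mathlib

/-- The defining relators of the braid group `B_n`. -/
def braidRels (n : ℕ) : Set (FreeGroup (Fin (n - 1))) :=
  {r | (∃ i j : Fin (n - 1), (j : ℕ) = (i : ℕ) + 1 ∧
          r = FreeGroup.of i * FreeGroup.of j * FreeGroup.of i *
              (FreeGroup.of j * FreeGroup.of i * FreeGroup.of j)⁻¹) ∨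
       (∃ i j : Fin (n - 1), ((i : ℕ) + 2 ≤ (j : ℕ) ∨ (j : ℕ) + 2 ≤ (i : ℕ)) ∧
          r = FreeGroup.of i * FreeGroup.of j * (FreeGroup.of i)⁻¹ * (FreeGroup.of j)⁻¹)}

/-- The braid group `B_n` as a presented group. -/
abbrev BraidGroup (n : ℕ) : Type := PresentedGroup (braidRels n)

/-- The transposition `(i, i+1)` in `S_n`, image of the braid generator `σ_i`. -/
def braidProjGen (n : ℕ) (i : Fin (n - 1)) : Equiv.Perm (Fin n) :=
  Equiv.swap ⟨i.val, by have := i.isLt; omega⟩ ⟨i.val + 1, by have := i.isLt; omega⟩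

/-- `π : B_n → S_n` is the canonical projection: it sends each braid generator
`σ_i` to the transposition `(i, i+1)`. -/
def IsBraidProj (n : ℕ) (π : BraidGroup n →* Equiv.Perm (Fin n)) : Prop :=
  ∀ i : Fin (n - 1), π (PresentedGroup.of i) = braidProjGen n i

/-- The transposition of `k` and `k + 1` in `Fin n`, or `1` when `k + 1` is out of range. -/
def adjSwap (n k : ℕ) : Equiv.Perm (Fin n) :=
  if h : k + 1 < n then Equiv.swap ⟨k, by omega⟩ ⟨k + 1, h⟩ else 1

theorem adjSwap_of_lt {n k : ℕ} (h : k + 1 < n) :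
    adjSwap n k = Equiv.swap ⟨k, by omega⟩ ⟨k + 1, h⟩ := dif_pos h

theorem adjSwap_apply_of_ne {n k : ℕ} {x : Fin n} (h₁ : (x : ℕ) ≠ k) (h₂ : (x : ℕ) ≠ k + 1) :
    adjSwap n k x = x := by
  unfold adjSwap
  split_ifs with h
  · exact Equiv.swap_apply_of_ne_of_ne (by simpa [Fin.ext_iff] using h₁)
      (by simpa [Fin.ext_iff] using h₂)
  · rfl

theorem adjSwap_mul_self (n k : ℕ) : adjSwap n k * adjSwap n k = 1 := by
  unfold adjSwap
  split_ifs <;> simp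

/-- A permutation fixing every point from `a` on is a product of adjacent transpositions
supported below `a`. -/
theorem mem_closure_adjSwap {n : ℕ} (a : ℕ) (p : Equiv.Perm (Fin n))
    (hp : ∀ x : Fin n, a ≤ x → p x = x) :
    p ∈ Subgroup.closure (adjSwap n '' {k | k + 1 < a}) := by
  induction a generalizing p with
  | zero =>
    have : p = 1 := Equiv.ext fun x => hp x (Nat.zero_le _)
    exact this ▸ one_mem _
  | succ a ih =>
    have mono : Subgroup.closure (adjSwap n '' {k | k + 1 < a}) ≤
        Subgroup.closure (adjSwap n '' {k | k + 1 < a + 1}) :=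
      Subgroup.closure_mono (Set.image_mono fun k (hk : k + 1 < a) => Nat.lt_succ_of_lt hk)
    by_cases han : a < n
    swap
    · exact mono (ih p fun x hx => absurd x.isLt (by omega))
    set A : Fin n := ⟨a, han⟩ with hA
    by_cases hfix : p A = A
    · refine mono (ih p fun x hx => ?_)
      rcases hx.eq_or_lt with h | h
      · have : x = A := Fin.ext h.symm
        rw [this, hfix]
      · exact hp x h
    set b := p A with hb
    have hba : (b : ℕ) < a := by
      by_contra hlt
      rcases (not_lt.1 hlt).eq_or_lt with h | h
      · exact hfix (Fin.ext h.symm)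
      · exact hfix (p.injective (hp b h))
    obtain ⟨c, rfl⟩ : ∃ c, a = c + 1 := ⟨a - 1, by omega⟩
    set C : Fin n := ⟨c, by omega⟩ with hC
    have hs : Equiv.swap C A ∈ Subgroup.closure (adjSwap n '' {k | k + 1 < c + 1 + 1}) :=
      Subgroup.subset_closure ⟨c, by simp, adjSwap_of_lt han⟩
    have hu : Equiv.swap C b ∈ Subgroup.closure (adjSwap n '' {k | k + 1 < c + 1 + 1}) := by
      refine mono (ih _ fun x hx => Equiv.swap_apply_of_ne_of_ne ?_ ?_) <;>
      · rintro rfl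
        simp [hC] at hx
        try omega
    have hr : Equiv.swap C A * Equiv.swap C b * p ∈
        Subgroup.closure (adjSwap n '' {k | k + 1 < c + 1 + 1}) := by
      refine mono (ih _ fun x hx => ?_)
      rcases hx.eq_or_lt with h | h
      · have : x = A := Fin.ext h.symm
        simp [this, ← hb]
      · have h₁ : x ≠ C := by rintro rfl; simp [hC] at h
        have h₂ : x ≠ A := by rintro rfl; simp [hA] at h
        have h₃ : x ≠ b := by rintro h'; rw [h'] at h; omega
        simp [hp x h, Equiv.swap_apply_of_ne_of_ne, h₁, h₂, h₃]
    exact (Subgroup.mul_mem_cancel_left _ (mul_mem hs hu)).1 hr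

section TypeA

variable {W : Type*} [Group W] {n : ℕ} {s : ℕ → W}

/-- `⟨s 0, …, s (a-1)⟩`. -/
def parabolic (s : ℕ → W) (a : ℕ) : Subgroup W := Subgroup.closure (s '' {k | k < a})

theorem mem_parabolic {a k : ℕ} (h : k < a) : s k ∈ parabolic s a :=
  Subgroup.subset_closure ⟨k, h, rfl⟩

theorem parabolic_mono {a b : ℕ} (h : a ≤ b) : parabolic s a ≤ parabolic s b :=
  Subgroup.closure_mono (Set.image_mono fun _ hk => lt_of_lt_of_le hk h)

theorem commute_of_mem_parabolic (hcomm : ∀ k l, k + 2 ≤ l → Commute (s k) (s l)) {a l : ℕ}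
    (hl : a + 1 ≤ l) {x : W} (hx : x ∈ parabolic s a) : Commute x (s l) := by
  have : parabolic s a ≤ Subgroup.centralizer {s l} := by
    refine (Subgroup.closure_le _).2 ?_
    rintro _ ⟨k, hk, rfl⟩
    exact Subgroup.mem_centralizer_singleton_iff.2 (hcomm k l (by simp at hk; omega)).eq
  exact Subgroup.mem_centralizer_singleton_iff.1 (this hx)

/-- The double coset decomposition `W_{a+1} = W_a ∪ W_a s_a W_a` in type `A`. -/
theorem mem_parabolic_succ (hsq : ∀ k, s k * s k = 1)
    (hcomm : ∀ k l, k + 2 ≤ l → Commute (s k) (s l))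
    (hbraid : ∀ k, k + 2 < n → s k * s (k + 1) * s k = s (k + 1) * s k * s (k + 1))
    (a : ℕ) (ha : a + 1 < n) (x : W) (hx : x ∈ parabolic s (a + 1)) :
    x ∈ parabolic s a ∨ ∃ u ∈ parabolic s a, ∃ v ∈ parabolic s a, x = u * s a * v := by
  have key : ∀ w ∈ parabolic s a, s a * w * s a ∈ parabolic s a ∨
      ∃ u ∈ parabolic s a, ∃ v ∈ parabolic s a, s a * w * s a = u * s a * v := by
    intro w hw
    cases a with
    | zero =>
      have : w = 1 := by simpa [parabolic] using hw
      exact Or.inl (by simp [this, hsq, one_mem])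
    | succ a =>
      have hsa : s a ∈ parabolic s (a + 1) := mem_parabolic (Nat.lt_succ_self a)
      rcases mem_parabolic_succ hsq hcomm hbraid a (by omega) w hw with
        h | ⟨u, hu, v, hv, rfl⟩
      · left
        rwa [← (commute_of_mem_parabolic hcomm le_rfl h).eq, mul_assoc, hsq, mul_one]
      · right
        refine ⟨u * s a, mul_mem (parabolic_mono (Nat.le_succ a) hu) hsa,
          s a * v, mul_mem hsa (parabolic_mono (Nat.le_succ a) hv), ?_⟩
        have h₁ := (commute_of_mem_parabolic hcomm le_rfl hu).eq
        have h₂ := (commute_of_mem_parabolic hcomm le_rfl hv).eq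
        calc s (a + 1) * (u * s a * v) * s (a + 1)
            = (s (a + 1) * u) * s a * (v * s (a + 1)) := by group
          _ = u * (s (a + 1) * s a * s (a + 1)) * v := by rw [← h₁, h₂]; group
          _ = u * s a * s (a + 1) * (s a * v) := by rw [← hbraid a (by omega)]; group
  have step : ∀ k < a + 1, ∀ z, (z ∈ parabolic s a ∨
      ∃ u ∈ parabolic s a, ∃ v ∈ parabolic s a, z = u * s a * v) →
      (s k * z ∈ parabolic s a ∨
        ∃ u ∈ parabolic s a, ∃ v ∈ parabolic s a, s k * z = u * s a * v) := by
    intro k hk z hz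
    rcases (Nat.lt_succ_iff.1 hk).eq_or_lt with rfl | hlt
    · rcases hz with hz | ⟨u, hu, v, hv, rfl⟩
      · exact Or.inr ⟨1, one_mem _, z, hz, by simp⟩
      · rcases key u hu with h | ⟨u', hu', v', hv', h⟩
        · exact Or.inl (by simpa [mul_assoc] using mul_mem h hv)
        · refine Or.inr ⟨u', hu', v' * v, mul_mem hv' hv, ?_⟩
          rw [← mul_assoc, ← mul_assoc, ← mul_assoc, h]
    · have hsk := mem_parabolic (s := s) hlt
      rcases hz with hz | ⟨u, hu, v, hv, rfl⟩
      · exact Or.inl (mul_mem hsk hz)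
      · exact Or.inr ⟨s k * u, mul_mem hsk hu, v, hv, by simp [mul_assoc]⟩
  induction hx using Subgroup.closure_induction_left with
  | one => exact Or.inl (one_mem _)
  | mul_left y hy z _ ih =>
    obtain ⟨k, hk, rfl⟩ := hy
    exact step k hk z ih
  | inv_mul_cancel y hy z _ ih =>
    obtain ⟨k, hk, rfl⟩ := hy
    rw [inv_eq_of_mul_eq_one_left (hsq k)]
    exact step k hk z ih

theorem map_apply_of_mem_parabolic {ρ : W →* Equiv.Perm (Fin n)}
    (hρ : ∀ k, ρ (s k) = adjSwap n k) {a : ℕ} {x : W} (hx : x ∈ parabolic s a)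
    {i : Fin n} (hi : a < i) : ρ x i = i := by
  have : parabolic s a ≤ (MulAction.stabilizer (Equiv.Perm (Fin n)) i).comap ρ := by
    refine (Subgroup.closure_le _).2 ?_
    rintro _ ⟨k, hk, rfl⟩
    simp only [Set.mem_ofPred_eq] at hk
    simp only [Subgroup.coe_comap, Set.mem_preimage, SetLike.mem_coe, MulAction.mem_stabilizer_iff,
      hρ, Equiv.Perm.smul_def]
    exact adjSwap_apply_of_ne (by omega) (by omega)
  exact this hx

/-- A group generated by involutions satisfying the braid relations of type `A` acts faithfully
by adjacent transpositions. -/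
theorem eq_one_of_mem_parabolic (hsq : ∀ k, s k * s k = 1)
    (hcomm : ∀ k l, k + 2 ≤ l → Commute (s k) (s l))
    (hbraid : ∀ k, k + 2 < n → s k * s (k + 1) * s k = s (k + 1) * s k * s (k + 1))
    {ρ : W →* Equiv.Perm (Fin n)} (hρ : ∀ k, ρ (s k) = adjSwap n k)
    (a : ℕ) (ha : a < n) (x : W) (hx : x ∈ parabolic s a) (h : ρ x = 1) : x = 1 := by
  induction a generalizing x with
  | zero => simpa [parabolic] using hx
  | succ a ih =>
    rcases mem_parabolic_succ hsq hcomm hbraid a ha x hx with hx | ⟨u, hu, v, hv, rfl⟩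
    · exact ih (by omega) x hx h
    · exfalso
      have h' := Equiv.Perm.congr_fun h ⟨a + 1, ha⟩
      rw [map_mul, map_mul, hρ, Equiv.Perm.mul_apply, Equiv.Perm.mul_apply,
        map_apply_of_mem_parabolic hρ hv (Nat.lt_succ_self a), adjSwap_of_lt ha,
        Equiv.swap_apply_right, Equiv.Perm.one_apply] at h'
      have hu' := map_apply_of_mem_parabolic hρ hu (i := ⟨a + 1, ha⟩) (Nat.lt_succ_self a)
      simpa using (ρ u).injective (h'.trans hu'.symm)

end TypeA

namespace BraidGroup

variable {n : ℕ}

/-- The `k`-th braid generator, or `1` when `k` is out of range. -/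
def gen (n k : ℕ) : BraidGroup n :=
  if h : k < n - 1 then PresentedGroup.of ⟨k, h⟩ else 1

theorem gen_of_lt {k : ℕ} (h : k < n - 1) : gen n k = PresentedGroup.of ⟨k, h⟩ := dif_pos h

theorem gen_braid (k : ℕ) (hk : k + 2 < n) :
    gen n k * gen n (k + 1) * gen n k = gen n (k + 1) * gen n k * gen n (k + 1) := by
  rw [gen_of_lt (by omega : k < n - 1), gen_of_lt (by omega : k + 1 < n - 1)]
  exact PresentedGroup.mk_eq_mk_of_mul_inv_mem (Or.inl ⟨⟨k, _⟩, ⟨k + 1, _⟩, rfl, rfl⟩)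

theorem gen_commute (k l : ℕ) (h : k + 2 ≤ l) : Commute (gen n k) (gen n l) := by
  by_cases hl : l < n - 1
  · rw [gen_of_lt hl, gen_of_lt (by omega : k < n - 1)]
    exact PresentedGroup.mk_eq_mk_of_mul_inv_mem
      (Or.inr ⟨⟨k, by omega⟩, ⟨l, hl⟩, Or.inl h, by group⟩)
  · rw [gen, gen, dif_neg hl]
    exact Commute.one_right _

theorem parabolic_gen_eq_top : parabolic (gen n) (n - 1) = ⊤ := by
  rw [← PresentedGroup.closure_range_of, parabolic]
  congr 1
  ext x
  constructor
  · rintro ⟨k, hk, rfl⟩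
    exact ⟨⟨k, hk⟩, (gen_of_lt hk).symm⟩
  · rintro ⟨i, rfl⟩
    exact ⟨i, i.isLt, gen_of_lt i.isLt⟩

theorem map_gen {π : BraidGroup n →* Equiv.Perm (Fin n)} (hπ : IsBraidProj n π) (k : ℕ) :
    π (gen n k) = adjSwap n k := by
  by_cases hk : k < n - 1
  · rw [gen_of_lt hk, hπ, adjSwap_of_lt (by omega)]
    rfl
  · rw [gen, dif_neg hk, adjSwap, dif_neg (by omega), map_one]

variable {π : BraidGroup n →* Equiv.Perm (Fin n)}

/-- The pure braid group is normally generated by the squares of the generators. -/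
theorem ker_le_normalClosure (hπ : IsBraidProj n π) (hn : 1 ≤ n) :
    π.ker ≤ Subgroup.normalClosure (Set.range fun k => gen n k * gen n k) := by
  set N := Subgroup.normalClosure (Set.range fun k => gen n k * gen n k)
  have hle : N ≤ π.ker := by
    refine Subgroup.normalClosure_le_normal ?_
    rintro _ ⟨k, rfl⟩
    simp [MonoidHom.mem_ker, map_gen hπ, adjSwap_mul_self]
  intro x hx
  rw [← QuotientGroup.eq_one_iff]
  refine eq_one_of_mem_parabolic (n := n) (s := fun k => (gen n k : BraidGroup n ⧸ N))
    (ρ := QuotientGroup.lift N π hle) (fun k => ?_) (fun k l h => ?_) (fun k h => ?_)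
    (fun k => map_gen hπ k) (n - 1) (by omega) _ ?_ hx
  · exact (QuotientGroup.eq_one_iff _).2 (Subgroup.subset_normalClosure ⟨k, rfl⟩)
  · exact (gen_commute k l h).map (QuotientGroup.mk' N)
  · exact congrArg (QuotientGroup.mk' N) (gen_braid k h)
  · have : (QuotientGroup.mk' N) x ∈ (parabolic (gen n) (n - 1)).map (QuotientGroup.mk' N) :=
      Subgroup.mem_map_of_mem _ (parabolic_gen_eq_top ▸ Subgroup.mem_top x)
    rw [parabolic, MonoidHom.map_closure, ← Set.image_comp] at this
    exact this

theorem isConj_gen {i j : ℕ} (hi : i + 1 < n) (hj : j + 1 < n) :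
    IsConj (gen n i) (gen n j) := by
  have key : ∀ k, k + 1 < n → IsConj (gen n 0) (gen n k) := by
    intro k hk
    induction k with
    | zero => exact IsConj.refl _
    | succ k ih =>
      refine (ih (by omega)).trans (isConj_iff.2 ⟨gen n k * gen n (k + 1), ?_⟩)
      rw [gen_braid k hk]
      group
  exact (key i hi).symm.trans (key j hj)

/-- Every permutation commuting with the last adjacent transposition lifts to a braid commuting
with the last generator. -/
theorem exists_lift_commute_last (hπ : IsBraidProj n π) {l : ℕ} (hl : l + 2 = n)
    (y : Equiv.Perm (Fin n)) (hy : Commute y (adjSwap n l)) :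
    ∃ z, π z = y ∧ Commute z (gen n l) := by
  have lift : ∀ y : Equiv.Perm (Fin n), Commute y (adjSwap n l) → y ⟨l, by omega⟩ = ⟨l, by omega⟩ →
      ∃ z, π z = y ∧ Commute z (gen n l) := by
    intro y hy hfix
    have hfix' : y ⟨l + 1, by omega⟩ = ⟨l + 1, by omega⟩ := by
      have := Equiv.Perm.congr_fun hy.eq ⟨l, by omega⟩
      rwa [adjSwap_of_lt (by omega), Equiv.Perm.mul_apply, Equiv.Perm.mul_apply, hfix,
        Equiv.swap_apply_left] at this
    have hmem := mem_closure_adjSwap l y fun x hx => by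
      have := x.isLt
      rcases hx.eq_or_lt with h | h
      · rwa [show x = ⟨l, by omega⟩ from Fin.ext h.symm]
      · rwa [show x = ⟨l + 1, by omega⟩ from Fin.ext (by simp; omega)]
    have hmap : adjSwap n '' {k | k + 1 < l} = π '' (gen n '' {k | k < l - 1}) := by
      rw [← Set.image_comp]
      simp only [Function.comp_def, map_gen hπ, Nat.lt_sub_iff_add_lt]
    rw [hmap, ← MonoidHom.map_closure] at hmem
    obtain ⟨z, hz, rfl⟩ := hmem
    refine ⟨z, rfl, ?_⟩
    rcases l with _ | l
    · have : z = 1 := by simpa using hz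
      exact this ▸ Commute.one_left _
    · exact commute_of_mem_parabolic gen_commute (a := l) le_rfl hz
  by_cases hfix : y ⟨l, by omega⟩ = ⟨l, by omega⟩
  · exact lift y hy hfix
  · have hne : y ⟨l, by omega⟩ = ⟨l + 1, by omega⟩ := by
      have := Equiv.Perm.congr_fun hy.eq ⟨l, by omega⟩
      by_contra hne
      rw [Equiv.Perm.mul_apply, Equiv.Perm.mul_apply, adjSwap_of_lt (by omega),
        Equiv.swap_apply_left, Equiv.swap_apply_of_ne_of_ne hfix hne] at this
      simpa using y.injective this
    obtain ⟨z, hz, hzc⟩ := lift (adjSwap n l * y) ((Commute.refl _).mul_left hy) (by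
      rw [Equiv.Perm.mul_apply, hne, adjSwap_of_lt (by omega), Equiv.swap_apply_right])
    refine ⟨gen n l * z, ?_, (Commute.refl _).mul_left hzc⟩
    rw [map_mul, hz, map_gen hπ, ← mul_assoc, adjSwap_mul_self, one_mul]

/-- Every permutation conjugating `s_i` to `s_j` lifts to a braid conjugating
`σ_i` to `σ_j`. -/
theorem exists_lift_conj (hπ : IsBraidProj n π) {i j : ℕ} (hi : i + 1 < n) (hj : j + 1 < n)
    (y : BraidGroup n) (hy : π y * adjSwap n i * (π y)⁻¹ = adjSwap n j) :
    ∃ z, π z = π y ∧ z * gen n i * z⁻¹ = gen n j := by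
  obtain ⟨l, hl⟩ : ∃ l, l + 2 = n := ⟨n - 2, by omega⟩
  obtain ⟨c, hc⟩ := isConj_iff.1 (isConj_gen (n := n) (by omega : l + 1 < n) hi)
  obtain ⟨d, hd⟩ := isConj_iff.1 (isConj_gen (n := n) (by omega : l + 1 < n) hj)
  have hc' := congrArg π hc
  have hd' := congrArg π hd
  simp only [map_mul, map_inv, map_gen hπ] at hc' hd'
  obtain ⟨z, hz, hzc⟩ := exists_lift_commute_last hπ hl (π (d⁻¹ * y * c)) (by
    rw [← hc', ← hd'] at hy
    rw [commute_iff_eq, ← mul_inv_eq_iff_eq_mul]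
    have := congrArg (fun t => (π d)⁻¹ * t * π d) hy
    simp only [map_mul, map_inv]
    simpa [mul_assoc] using this)
  refine ⟨d * z * c⁻¹, ?_, ?_⟩
  · rw [map_mul, map_mul, hz]
    simp [mul_assoc]
  · rw [← hc, ← hd]
    have := hzc.eq
    calc d * z * c⁻¹ * (c * gen n l * c⁻¹) * (d * z * c⁻¹)⁻¹
        = d * (z * gen n l) * z⁻¹ * d⁻¹ := by group
      _ = d * gen n l * d⁻¹ := by rw [this]; group

end BraidGroup

section Crossing

variable {X : Type*} [Group X]

/-- The conjugation action of a group on its free abelian group. -/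
noncomputable def conjFinsupp (X : Type*) [Group X] : X →* MulAut (Multiplicative (X →₀ ℤ)) where
  toFun g := AddEquiv.toMultiplicative (Finsupp.domCongr (MulAut.conj g).toEquiv)
  map_one' := by
    ext x : 1
    refine Multiplicative.toAdd.injective (Finsupp.ext fun y => ?_)
    simp [Finsupp.equivMapDomain_apply, ← MulAut.inv_def]
  map_mul' g h := by
    ext x : 1
    refine Multiplicative.toAdd.injective (Finsupp.ext fun y => ?_)
    simp [Finsupp.equivMapDomain_apply, ← MulAut.inv_def]

theorem conjFinsupp_apply (g : X) (f : X →₀ ℤ) :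
    conjFinsupp X g (Multiplicative.ofAdd f) =
      Multiplicative.ofAdd (f.mapDomain fun x => g * x * g⁻¹) := by
  refine Multiplicative.toAdd.injective ?_
  exact Finsupp.equivMapDomain_eq_mapDomain _ _

/-- The element `(δ_s, s)` of `ℤ[X] ⋊ X`. -/
noncomputable def crossingGen (s : X) : Multiplicative (X →₀ ℤ) ⋊[conjFinsupp X] X :=
  ⟨Multiplicative.ofAdd (Finsupp.single s 1), s⟩

theorem crossingGen_commute {s t : X} (h : s * t = t * s) :
    crossingGen s * crossingGen t = crossingGen t * crossingGen s := by
  have h₁ : s * t * s⁻¹ = t := by rw [h]; group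
  have h₂ : t * s * t⁻¹ = s := by rw [← h]; group
  refine SemidirectProduct.ext ?_ h
  simp only [SemidirectProduct.mul_left, crossingGen, conjFinsupp_apply, Finsupp.mapDomain_single,
    h₁, h₂]
  exact mul_comm _ _

theorem crossingGen_braid {s t : X} (hs : s * s = 1) (ht : t * t = 1)
    (h : s * t * s = t * s * t) :
    crossingGen s * crossingGen t * crossingGen s =
      crossingGen t * crossingGen s * crossingGen t := by
  have hs' := inv_eq_of_mul_eq_one_left hs
  have ht' := inv_eq_of_mul_eq_one_left ht
  have h₁ : s * t * s * (s * t)⁻¹ = t := by rw [h]; group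
  have h₂ : t * s * t * (t * s)⁻¹ = s := by rw [← h]; group
  refine SemidirectProduct.ext ?_ h
  simp only [SemidirectProduct.mul_left, SemidirectProduct.mul_right, crossingGen,
    conjFinsupp_apply, Finsupp.mapDomain_single, h₁, h₂]
  rw [hs', ht', h, mul_right_comm, mul_comm (Multiplicative.ofAdd (Finsupp.single s 1)),
    mul_right_comm, mul_right_comm (Multiplicative.ofAdd (Finsupp.single t 1))]

end Crossing

namespace BraidGroup

variable {n : ℕ} {π : BraidGroup n →* Equiv.Perm (Fin n)}

theorem braidProjGen_eq (i : Fin (n - 1)) : braidProjGen n i = adjSwap n i :=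
  (adjSwap_of_lt _).symm

/-- The crossed homomorphism counting the signed crossings of each pair of strands of a braid,
a pair being encoded as a transposition. -/
theorem exists_crossing_hom (hπ : IsBraidProj n π) :
    ∃ w : BraidGroup n → (Equiv.Perm (Fin n) →₀ ℤ),
      (∀ k, k + 1 < n → w (gen n k) = Finsupp.single (adjSwap n k) 1) ∧
      ∀ g h, w (g * h) = w g + (w h).mapDomain fun x => π g * x * (π g)⁻¹ := by
  let f : Fin (n - 1) → Multiplicative (Equiv.Perm (Fin n) →₀ ℤ) ⋊[conjFinsupp _]
      Equiv.Perm (Fin n) := fun i => crossingGen (braidProjGen n i)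
  have hrel : ∀ r ∈ braidRels n, FreeGroup.lift f r = 1 := by
    rintro r (⟨i, j, hij, rfl⟩ | ⟨i, j, hij, rfl⟩)
    · simp only [map_mul, map_inv, FreeGroup.lift_apply_of, mul_inv_eq_one]
      refine crossingGen_braid ?_ ?_ ?_
      · rw [braidProjGen_eq, adjSwap_mul_self]
      · rw [braidProjGen_eq, adjSwap_mul_self]
      · have := congrArg π (gen_braid (n := n) i (by omega))
        simpa only [braidProjGen_eq, hij, map_mul, map_gen hπ] using this
    · have : f i * f j = f j * f i := by
        refine crossingGen_commute ?_
        simp only [braidProjGen_eq, ← map_gen hπ, ← map_mul]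
        rcases hij with h | h
        · rw [(gen_commute _ _ h).eq]
        · rw [(gen_commute _ _ h).eq]
      simp only [map_mul, map_inv, FreeGroup.lift_apply_of, this]
      group
  let Ψ := PresentedGroup.toGroup hrel
  have hright : SemidirectProduct.rightHom.comp Ψ = π :=
    PresentedGroup.ext fun i => by simp [Ψ, f, crossingGen, hπ i]
  refine ⟨fun b => (Ψ b).left.toAdd, fun k hk => ?_, fun g h => ?_⟩
  · rw [gen_of_lt (by omega)]
    simp [Ψ, f, crossingGen, braidProjGen_eq]
  · have hg : (Ψ g).right = π g := DFunLike.congr_fun hright g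
    simp only [map_mul, SemidirectProduct.mul_left]
    rw [hg, ← ofAdd_toAdd (Ψ h).left, conjFinsupp_apply]
    rfl

/-- A homomorphism from the pure braid group to an abelian group that is invariant under
conjugation by `π⁻¹(G)` kills every pure braid in the commutator subgroup of `π⁻¹(G)`. -/
theorem eq_one_of_mem_commutator (hπ : IsBraidProj n π) (hn : 1 ≤ n)
    (G : Subgroup (Equiv.Perm (Fin n))) {A : Type*} [CommGroup A] (φ : π.ker →* A)
    (hφ : ∀ h ∈ G.comap π, ∀ p q : π.ker, (q : BraidGroup n) = h * p * h⁻¹ → φ q = φ p)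
    (p : π.ker) (hp : ∀ x : G.comap π, (x : BraidGroup n) = p → x ∈ commutator (G.comap π)) :
    φ p = 1 := by
  obtain ⟨w, hgen, hmul⟩ := exists_crossing_hom hπ
  have hid : ∀ f : Equiv.Perm (Fin n) →₀ ℤ, (f.mapDomain fun x => 1 * x * 1⁻¹) = f := by
    intro f
    simp only [one_mul, inv_one, mul_one]
    exact Finsupp.mapDomain_id
  have hw1 : w 1 = 0 := by
    have := hmul 1 1
    rwa [map_one, hid, mul_one, left_eq_add] at this
  have hker : ∀ x ∈ π.ker, ∀ y, w (x * y) = w x + w y := by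
    intro x hx y
    rw [hmul, MonoidHom.mem_ker.1 hx, hid]
  have hinv : ∀ x ∈ π.ker, w x⁻¹ = - w x := by
    intro x hx
    rw [eq_neg_iff_add_eq_zero, ← hker _ (inv_mem hx), inv_mul_cancel, hw1]
  -- the square of a generator, conjugated by a braid
  have hsq : ∀ g k, g * (gen n k * gen n k) * g⁻¹ ∈ π.ker := fun g k => by
    simp [MonoidHom.mem_ker, map_gen hπ, adjSwap_mul_self]
  have hwsq : ∀ g k, k + 1 < n → w (g * (gen n k * gen n k) * g⁻¹) =
      (2 : ℤ) • Finsupp.single (π g * adjSwap n k * (π g)⁻¹) 1 := by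
    intro g k hk
    have h₁ : w (gen n k * gen n k) = (2 : ℤ) • Finsupp.single (adjSwap n k) 1 := by
      rw [hmul, hgen k hk, map_gen hπ, Finsupp.mapDomain_single, mul_inv_cancel_right, two_smul]
    have h₂ : w g + (w g⁻¹).mapDomain (fun x => π g * x * (π g)⁻¹) = 0 := by
      rw [← hmul, mul_inv_cancel, hw1]
    rw [hmul, hmul, h₁, map_mul, map_mul, map_gen hπ, adjSwap_mul_self, mul_one,
      add_right_comm, h₂, zero_add, Finsupp.mapDomain_smul, Finsupp.mapDomain_single]
  -- orbits of transpositions under conjugation by `G`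
  let r : Setoid (Equiv.Perm (Fin n)) :=
    { r := fun s t => ∃ h ∈ G.comap π, π h * s * (π h)⁻¹ = t
      iseqv :=
        { refl := fun s => ⟨1, one_mem _, by simp⟩
          symm := by
            rintro s _ ⟨h, hh, rfl⟩
            exact ⟨h⁻¹, inv_mem hh, by simp [mul_assoc]⟩
          trans := by
            rintro s _ _ ⟨h, hh, rfl⟩ ⟨h', hh', rfl⟩
            exact ⟨h' * h, mul_mem hh' hh, by simp [mul_assoc]⟩ } }
  let c : Equiv.Perm (Fin n) → Quotient r := Quotient.mk r
  have hc : ∀ h ∈ G.comap π, ∀ f : Equiv.Perm (Fin n) →₀ ℤ,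
      (f.mapDomain fun x => π h * x * (π h)⁻¹).mapDomain c = f.mapDomain c := by
    intro h hh f
    rw [← Finsupp.mapDomain_comp]
    refine Finsupp.mapDomain_congr fun x _ => Quotient.sound (Setoid.symm ⟨h, hh, rfl⟩)
  have hwell : ∀ g k g' k', k + 1 < n → k' + 1 < n →
      c (π g * adjSwap n k * (π g)⁻¹) = c (π g' * adjSwap n k' * (π g')⁻¹) →
      φ ⟨_, hsq g k⟩ = φ ⟨_, hsq g' k'⟩ := by
    intro g k g' k' hk hk' heq
    obtain ⟨h, hh, hconj⟩ := Quotient.exact heq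
    obtain ⟨z, hz, hzc⟩ := exists_lift_conj hπ hk hk' (g'⁻¹ * h * g) (by
      have := congrArg (fun t => (π g')⁻¹ * t * π g') hconj
      simpa [mul_assoc] using this)
    -- the lift below agrees with `h` up to a pure braid
    refine (hφ (g' * z * g⁻¹) ?_ _ _ ?_).symm
    · have : π (g' * z * g⁻¹) = π h := by simp [hz, mul_assoc]
      rw [Subgroup.mem_comap, this]
      exact hh
    · change g' * (gen n k' * gen n k') * g'⁻¹ = _
      rw [← hzc]
      group
  let a : Quotient r → Additive A := fun o =>
    open Classical in
    if ho : ∃ gk : BraidGroup n × ℕ, gk.2 + 1 < n ∧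
        c (π gk.1 * adjSwap n gk.2 * (π gk.1)⁻¹) = o
    then Additive.ofMul (φ ⟨_, hsq ho.choose.1 ho.choose.2⟩) else 0
  have ha : ∀ g k, k + 1 < n → a (c (π g * adjSwap n k * (π g)⁻¹)) =
      Additive.ofMul (φ ⟨_, hsq g k⟩) := by
    intro g k hk
    have ho : ∃ gk : BraidGroup n × ℕ, gk.2 + 1 < n ∧
        c (π gk.1 * adjSwap n gk.2 * (π gk.1)⁻¹) = c (π g * adjSwap n k * (π g)⁻¹) :=
      ⟨(g, k), hk, rfl⟩
    simp only [a]
    rw [dif_pos ho]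
    exact congrArg _ (hwell _ _ _ _ ho.choose_spec.1 hk ho.choose_spec.2)
  let Φ : (Quotient r →₀ ℤ) →+ Additive A := Finsupp.liftAddHom fun o => zmultiplesHom _ (a o)
  have hle : Subgroup.normalClosure (Set.range fun k => gen n k * gen n k) ≤ π.ker := by
    refine Subgroup.normalClosure_le_normal ?_
    rintro _ ⟨k, rfl⟩
    simpa using hsq 1 k
  have main : ∀ x ∈ Subgroup.normalClosure (Set.range fun k => gen n k * gen n k),
      ∀ hx : x ∈ π.ker, ∃ v : Equiv.Perm (Fin n) →₀ ℤ, w x = (2 : ℤ) • v ∧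
        Additive.ofMul (φ ⟨x, hx⟩) = Φ (v.mapDomain c) := by
    intro x hxN
    induction hxN using Subgroup.closure_induction with
    | mem x hxS =>
      intro hx
      obtain ⟨_, ⟨k, rfl⟩, hconj⟩ := Group.mem_conjugatesOfSet_iff.1 hxS
      obtain ⟨g, rfl⟩ := isConj_iff.1 hconj
      by_cases hk : k + 1 < n
      · refine ⟨Finsupp.single (π g * adjSwap n k * (π g)⁻¹) 1, hwsq g k hk, ?_⟩
        rw [Finsupp.mapDomain_single, ← ha g k hk]
        simp [Φ]
      · have hone : g * (gen n k * gen n k) * g⁻¹ = 1 := by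
          rw [gen, dif_neg (by omega)]
          group
        refine ⟨0, by simp only [hone, hw1, smul_zero], ?_⟩
        have : (⟨_, hx⟩ : π.ker) = 1 := Subtype.ext hone
        rw [this]
        simp
    | one =>
      intro hx
      refine ⟨0, by simp [hw1], ?_⟩
      have : (⟨1, hx⟩ : π.ker) = 1 := rfl
      rw [this]
      simp
    | mul x y hxN hyN ihx ihy =>
      intro hxy
      obtain ⟨v, hv, hφv⟩ := ihx (hle hxN)
      obtain ⟨u, hu, hφu⟩ := ihy (hle hyN)
      refine ⟨v + u, by rw [hker x (hle hxN), hv, hu, smul_add], ?_⟩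
      have : (⟨x * y, hxy⟩ : π.ker) = ⟨x, hle hxN⟩ * ⟨y, hle hyN⟩ := rfl
      rw [this, map_mul, ofMul_mul, hφv, hφu, Finsupp.mapDomain_add, map_add]
    | inv x hxN ih =>
      intro hx
      obtain ⟨v, hv, hφv⟩ := ih (hle hxN)
      refine ⟨-v, by rw [hinv x (hle hxN), hv, smul_neg], ?_⟩
      have : (⟨x⁻¹, hx⟩ : π.ker) = ⟨x, hle hxN⟩⁻¹ := rfl
      have hneg : (-v).mapDomain c = -v.mapDomain c :=
        map_neg (Finsupp.mapDomain.addMonoidHom c) v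
      rw [this, map_inv, ofMul_inv, hφv, hneg, map_neg]
  obtain ⟨v, hv, hφv⟩ := main p (ker_le_normalClosure hπ hn p.2) p.2
  let ω : G.comap π →* Multiplicative (Quotient r →₀ ℤ) :=
    { toFun := fun x => Multiplicative.ofAdd ((w x).mapDomain c)
      map_one' := by simp [hw1]
      map_mul' := fun x y => by
        rw [Subgroup.coe_mul, hmul, Finsupp.mapDomain_add, hc _ x.2]
        rfl }
  have hpG : (p : BraidGroup n) ∈ G.comap π := by
    rw [Subgroup.mem_comap, MonoidHom.mem_ker.1 p.2]
    exact one_mem _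
  have hω : ω ⟨p, hpG⟩ = 1 := Abelianization.commutator_subset_ker ω (hp ⟨p, hpG⟩ rfl)
  have hzero : (2 : ℤ) • v.mapDomain c = 0 := by
    rw [← Finsupp.mapDomain_smul, ← hv]
    exact hω
  have : v.mapDomain c = 0 := (smul_eq_zero.1 hzero).resolve_left two_ne_zero
  rw [this, map_zero] at hφv
  exact hφv

/-- In `G̃ = π⁻¹(G)`, a pure braid lying in `[G̃, G̃]` already lies in `[G̃, PB_n]`. -/
theorem mem_commutator_ker (hπ : IsBraidProj n π) (hn : 1 ≤ n)
    (G : Subgroup (Equiv.Perm (Fin n))) (x : G.comap π)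
    (hx : x ∈ (π.comp (G.comap π).subtype).ker) (hx' : x ∈ commutator (G.comap π)) :
    x ∈ ⁅(⊤ : Subgroup (G.comap π)), (π.comp (G.comap π).subtype).ker⁆ := by
  set N := ⁅(⊤ : Subgroup (G.comap π)), (π.comp (G.comap π).subtype).ker⁆
  have hle : π.ker ≤ G.comap π := fun p hp => by
    rw [Subgroup.mem_comap, MonoidHom.mem_ker.1 hp]
    exact one_mem _
  have hcomm : ∀ (h : G.comap π) (p : π.ker),
      (h * Subgroup.inclusion hle p : G.comap π ⧸ N) =
        Subgroup.inclusion hle p * h := by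
    intro h p
    rw [← mul_inv_eq_one, mul_inv_rev, ← mul_assoc]
    exact (QuotientGroup.eq_one_iff _).2 (Subgroup.commutator_mem_commutator
      (Subgroup.mem_top h) (show Subgroup.inclusion hle p ∈ _ from p.2))
  let φ : π.ker →* Subgroup.center (G.comap π ⧸ N) :=
    ((QuotientGroup.mk' N).comp (Subgroup.inclusion hle)).codRestrict _ fun p => by
      rw [Subgroup.mem_center_iff]
      intro g
      induction g using QuotientGroup.induction_on with
      | H h => exact hcomm h p
  let _ : CommGroup (Subgroup.center (G.comap π ⧸ N)) :=
    { (inferInstance : Group (Subgroup.center (G.comap π ⧸ N))) with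
      mul_comm := fun a b => Subtype.ext (Subgroup.mem_center_iff.1 b.2 a) }
  have := eq_one_of_mem_commutator hπ hn G (A := Subgroup.center (G.comap π ⧸ N)) φ
    (fun h hh p q hpq => ?_) ⟨x, hx⟩ (fun y hy => by rwa [Subtype.ext hy])
  · exact (QuotientGroup.eq_one_iff _).1 (congrArg Subtype.val this)
  · refine Subtype.ext ?_
    have hq : Subgroup.inclusion hle q =
        ⟨h, hh⟩ * Subgroup.inclusion hle p * ⟨h, hh⟩⁻¹ := Subtype.ext hpq
    change (Subgroup.inclusion hle q : G.comap π ⧸ N) = Subgroup.inclusion hle p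
    rw [hq, QuotientGroup.mk_mul, QuotientGroup.mk_mul, hcomm, QuotientGroup.mk_inv,
      mul_inv_cancel_right]

end BraidGroup

/-- for any subgroup `G ≤ S_n` with preimage `G̃ = π⁻¹(G) ≤ B_n`,
the induced map `H₂(G̃; ℤ) → H₂(G; ℤ)` is surjective.  Via Hopf's formula
`H₂(Γ; ℤ) ≅ (R ∩ [F,F])/⁅F,R⁆` this says: given a presentation
`q : F ↠ G̃` of `G̃` by a finitely generated free group `F`, with `R̃ = ker q`
and `R` the kernel of the composite `F → G̃ → G`, every `w ∈ R ∩ [F,F]` agrees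
modulo `⁅F,R⁆` with some `w' ∈ R̃ ∩ [F,F]`. -/
theorem H2_preimage_to_H2_surjective
    (n : ℕ) (hn : 1 ≤ n)
    (π : BraidGroup n →* Equiv.Perm (Fin n)) (hπ : IsBraidProj n π)
    (G : Subgroup (Equiv.Perm (Fin n)))
    (ι : Type) [Finite ι]
    (q : FreeGroup ι →* (G.comap π)) (hq : Function.Surjective q) :
    ∀ w ∈ ((π.comp (G.comap π).subtype).comp q).ker ⊓ commutator (FreeGroup ι),
      ∃ w' ∈ q.ker ⊓ commutator (FreeGroup ι),
        w * w'⁻¹ ∈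
          ⁅(⊤ : Subgroup (FreeGroup ι)), ((π.comp (G.comap π).subtype).comp q).ker⁆ := by
  rintro w ⟨hw, hw'⟩
  have hmap : ⁅(⊤ : Subgroup (FreeGroup ι)), ((π.comp (G.comap π).subtype).comp q).ker⁆.map q =
      ⁅(⊤ : Subgroup (G.comap π)), (π.comp (G.comap π).subtype).ker⁆ := by
    rw [Subgroup.map_commutator, Subgroup.map_top_of_surjective q hq, ← MonoidHom.comap_ker,
      Subgroup.map_comap_eq_self_of_surjective hq]
  have hqw : q w ∈ commutator (G.comap π) := by
    have := Subgroup.mem_map_of_mem q hw'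
    rwa [commutator_def, Subgroup.map_commutator, Subgroup.map_top_of_surjective q hq] at this
  have hmem := BraidGroup.mem_commutator_ker hπ hn G (q w) hw hqw
  rw [← hmap] at hmem
  obtain ⟨c, hc, hcw⟩ := hmem
  have hc' : c ∈ commutator (FreeGroup ι) := Subgroup.commutator_mono le_rfl le_top hc
  refine ⟨c⁻¹ * w, ⟨?_, mul_mem ((commutator _).inv_mem hc') hw'⟩, ?_⟩
  · simp [hcw]
  · simpa using hc
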